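/- arXiv:1509.02465 — 7 statements merged into one kernel-verified Lean document; each statement's English description precedes it below -/
import Mathlib

section
/- Let H be a real Hilbert space, let S, T : H → H be orthogonal projections, and fix f ∈ H. Suppose f̂ ∈ H satisfies S f̂ = S f and (I − S)(I − T) f̂ = 0. Then for every α ∈ (0, 1], setting ρ = (1 − α)/α and f̂_α = α f̂ + (1 − α) T f̂, one has (S + ρ(I − T)) f̂_α = S f. -/
open scoped RealInnerProductSpace

theorem stmt_0 {H : Type*} [NormedAddCommGroup H] [InnerProductSpace ℝ H] [CompleteSpace H]
    (S T : H →L[ℝ] H)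
    (hS_idem : ∀ x, S (S x) = S x)
    (hS_sa : ∀ x y, ⟪S x, y⟫ = ⟪x, S y⟫)
    (hT_idem : ∀ x, T (T x) = T x)
    (hT_sa : ∀ x y, ⟪T x, y⟫ = ⟪x, T y⟫)
    (f fhat : H)
    (hcons : S fhat = S f)
    (hopt : (fhat - T fhat) - S (fhat - T fhat) = 0) :
    ∀ α : ℝ, 0 < α → α ≤ 1 →
      S (α • fhat + (1 - α) • T fhat) +
        ((1 - α) / α) • ((α • fhat + (1 - α) • T fhat) - T (α • fhat + (1 - α) • T fhat))
      = S f := by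
  intro α hα _
  have hres : fhat - T fhat = S fhat - S (T fhat) := by
    rw [← map_sub]
    exact sub_eq_zero.mp hopt
  have hT : (α • fhat + (1 - α) • T fhat) - T (α • fhat + (1 - α) • T fhat)
      = α • (fhat - T fhat) := by
    simp only [map_add, map_smul, hT_idem]
    module
  rw [hT, smul_smul, div_mul_cancel₀ _ hα.ne', hres, ← hcons]
  simp only [map_add, map_smul]
  module
end

section
/- Let H be a real Hilbert space, let S, T : H → H be orthogonal projections, and fix f ∈ H. Suppose f̂ ∈ H satisfies S f̂ = S f and (I − S)(I − T) f̂ = 0. Then for every α ∈ (0, 1], setting ρ = (1 − α)/α and f̂_α = α f̂ + (1 − α) T f̂, the vector f̂_α minimizes the regularized objective over H: for every g ∈ H, ‖S f̂_α − S f‖² + ρ ‖f̂_α − T f̂_α‖² ≤ ‖S g − S f‖² + ρ ‖g − T g‖². -/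
open scoped RealInnerProductSpace

theorem stmt_1 {H : Type*} [NormedAddCommGroup H] [InnerProductSpace ℝ H] [CompleteSpace H]
    (S T : H →L[ℝ] H)
    (hS_idem : ∀ x, S (S x) = S x)
    (hS_sa : ∀ x y, ⟪S x, y⟫ = ⟪x, S y⟫)
    (hT_idem : ∀ x, T (T x) = T x)
    (hT_sa : ∀ x y, ⟪T x, y⟫ = ⟪x, T y⟫)
    (f fhat : H)
    (hcons : S fhat = S f)
    (hopt : (fhat - T fhat) - S (fhat - T fhat) = 0) :
    ∀ α : ℝ, 0 < α → α ≤ 1 →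
      ∀ g : H,
        ‖S (α • fhat + (1 - α) • T fhat) - S f‖ ^ 2 +
            ((1 - α) / α) *
              ‖(α • fhat + (1 - α) • T fhat) - T (α • fhat + (1 - α) • T fhat)‖ ^ 2
          ≤ ‖S g - S f‖ ^ 2 + ((1 - α) / α) * ‖g - T g‖ ^ 2 := by
  intro α hα hα1 g
  set e := fhat - T fhat with he
  have hSe : S e = e := (sub_eq_zero.mp hopt).symm
  have hTe : T e = 0 := by rw [he, map_sub, hT_idem, sub_self]
  have hx : α • fhat + (1 - α) • T fhat = fhat - (1 - α) • e := by
    rw [he]; module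
  have hSx : S (fhat - (1 - α) • e) - S f = -((1 - α) • e) := by
    rw [map_sub, map_smul, hSe, hcons]; abel
  have hTx : fhat - (1 - α) • e - T (fhat - (1 - α) • e) = α • e := by
    rw [map_sub, map_smul, hTe, he]; module
  have hfe : ⟪fhat, e⟫ = ‖e‖ ^ 2 := by
    have h : ⟪T fhat, e⟫ = 0 := by rw [hT_sa, hTe, inner_zero_right]
    rw [← real_inner_self_eq_norm_sq e]
    nth_rw 2 [he]
    rw [inner_sub_left, h, sub_zero]
  have hu : ⟪S g - S f, e⟫ = ⟪g, e⟫ - ‖e‖ ^ 2 := by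
    rw [← hcons, inner_sub_left, hS_sa, hS_sa, hSe, hfe]
  have hv : ⟪g - T g, e⟫ = ⟪g, e⟫ := by
    rw [inner_sub_left, hT_sa, hTe, inner_zero_right, sub_zero]
  rw [hx, hSx, hTx, norm_neg, norm_smul, norm_smul, mul_pow, mul_pow, Real.norm_eq_abs,
    Real.norm_eq_abs, sq_abs, sq_abs]
  have hu_sq : 0 ≤ ‖(S g - S f) + (1 - α) • e‖ ^ 2 := sq_nonneg _
  have hv_sq : 0 ≤ (1 - α) / α * ‖(g - T g) - α • e‖ ^ 2 :=
    mul_nonneg (div_nonneg (sub_nonneg.mpr hα1) hα.le) (sq_nonneg _)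
  rw [norm_add_sq_real, inner_smul_right, hu, norm_smul, mul_pow, Real.norm_eq_abs,
    sq_abs] at hu_sq
  rw [norm_sub_sq_real, inner_smul_right, hv, norm_smul, mul_pow, Real.norm_eq_abs,
    sq_abs] at hv_sq
  have hρ : (1 - α) / α * α = 1 - α := div_mul_cancel₀ _ hα.ne'
  generalize (1 - α) / α = ρ at *
  linear_combination hu_sq + hv_sq + (2 * α * ‖e‖ ^ 2 - 2 * ⟪g, e⟫) * hρ
end

section
/- Let H be a real Hilbert space, let S, T : H → H be orthogonal projections, and fix f ∈ H. A vector x̂ ∈ ker S minimizes the quadratic functional x ↦ ⟪x + S f, (I − T)(x + S f)⟫ over ker S if and only if (I − S)(I − T)(x̂ + S f) = 0. -/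
open scoped RealInnerProductSpace

section QuadraticForm

variable {H : Type*} [NormedAddCommGroup H] [InnerProductSpace ℝ H]

/-- Second-order expansion of the quadratic form of `I - T` for symmetric `T`. -/
theorem inner_add_sub_map_add (T : H →L[ℝ] H) (hT : ∀ x y, ⟪T x, y⟫ = ⟪x, T y⟫) (v d : H) :
    ⟪v + d, (v + d) - T (v + d)⟫ = ⟪v, v - T v⟫ + 2 * ⟪d, v - T v⟫ + ⟪d, d - T d⟫ := by
  simp only [map_add, inner_add_left, inner_sub_right, inner_add_right]
  rw [← hT v d, real_inner_comm d (T v), real_inner_comm d v]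
  ring

/-- Pythagoras for a symmetric idempotent `T`. -/
theorem inner_sub_map_eq (T : H →L[ℝ] H) (hT_idem : ∀ x, T (T x) = T x)
    (hT : ∀ x y, ⟪T x, y⟫ = ⟪x, T y⟫) (d : H) :
    ⟪d, d - T d⟫ = ⟪d, d⟫ - ⟪T d, T d⟫ := by
  rw [inner_sub_right, hT d (T d), hT_idem]

theorem inner_sub_map_nonneg (T : H →L[ℝ] H) (hT_idem : ∀ x, T (T x) = T x)
    (hT : ∀ x y, ⟪T x, y⟫ = ⟪x, T y⟫) (d : H) : 0 ≤ ⟪d, d - T d⟫ := by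
  have h : ⟪d, d - T d⟫ = ⟪d - T d, d - T d⟫ := by
    rw [inner_sub_left d (T d), hT d, map_sub, hT_idem, sub_self, inner_zero_right, sub_zero]
  rw [h]
  exact real_inner_self_nonneg

end QuadraticForm

theorem stmt_4 {H : Type*} [NormedAddCommGroup H] [InnerProductSpace ℝ H] [CompleteSpace H]
    (S T : H →L[ℝ] H)
    (hS_idem : ∀ x, S (S x) = S x)
    (hS_sa : ∀ x y, ⟪S x, y⟫ = ⟪x, S y⟫)
    (hT_idem : ∀ x, T (T x) = T x)
    (hT_sa : ∀ x y, ⟪T x, y⟫ = ⟪x, T y⟫)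
    (f : H) (xhat : H) (hxhat : S xhat = 0) :
    (∀ x : H, S x = 0 →
        ⟪xhat + S f, (xhat + S f) - T (xhat + S f)⟫ ≤
          ⟪x + S f, (x + S f) - T (x + S f)⟫)
      ↔ ((xhat + S f) - T (xhat + S f)) - S ((xhat + S f) - T (xhat + S f)) = 0 := by
  set v := xhat + S f with hv
  set w := v - T v with hw
  constructor
  · intro hmin
    set g := w - S w with hg
    have hSg : S g = 0 := by rw [hg, map_sub, hS_idem, sub_self]
    have hgw : ⟪g, w⟫ = ⟪g, g⟫ := by
      conv_rhs => rw [hg, inner_sub_right, ← hg, ← hS_sa, hSg, inner_zero_left, sub_zero]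
    have hle := hmin (xhat - g) (by rw [map_sub, hxhat, hSg, sub_zero])
    rw [show xhat - g + S f = v + -g by rw [hv]; abel, inner_add_sub_map_add T hT_sa v,
      inner_sub_map_eq T hT_idem hT_sa (-g), ← hw, inner_neg_left, inner_neg_neg, hgw] at hle
    have hTg : 0 ≤ ⟪T (-g), T (-g)⟫ := real_inner_self_nonneg
    exact (inner_self_eq_zero (𝕜 := ℝ)).mp (le_antisymm (by linarith) real_inner_self_nonneg)
  · intro hzero x hx
    have hdw : ⟪x - xhat, w⟫ = 0 := by
      rw [sub_eq_zero.mp hzero, ← hS_sa, map_sub, hx, hxhat, sub_zero, inner_zero_left]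
    have hd := inner_sub_map_nonneg T hT_idem hT_sa (x - xhat)
    rw [show x + S f = v + (x - xhat) by rw [hv]; abel, inner_add_sub_map_add T hT_sa v,
      ← hw, hdw]
    linarith
end

section
/- Let H be a real Hilbert space, let S, T : H → H be orthogonal projections, and fix f ∈ H. Suppose f̂ ∈ H satisfies S f̂ = S f and (I − S)(I − T) f̂ = 0. Then the pair (f̂, T f̂) attains the shortest distance between the sample-consistent plane and the guiding subspace: for every g ∈ H with S g = S f and every t ∈ H with T t = t, ‖f̂ − T f̂‖ ≤ ‖g − t‖. -/
open scoped RealInnerProductSpace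

theorem stmt_7 {H : Type*} [NormedAddCommGroup H] [InnerProductSpace ℝ H] [CompleteSpace H]
    (S T : H →L[ℝ] H)
    (hS_idem : ∀ x, S (S x) = S x)
    (hS_sa : ∀ x y, ⟪S x, y⟫ = ⟪x, S y⟫)
    (hT_idem : ∀ x, T (T x) = T x)
    (hT_sa : ∀ x y, ⟪T x, y⟫ = ⟪x, T y⟫)
    (f fhat : H)
    (hcons : S fhat = S f)
    (hopt : (fhat - T fhat) - S (fhat - T fhat) = 0) :
    ∀ g t : H, S g = S f → T t = t → ‖fhat - T fhat‖ ≤ ‖g - t‖ := by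
  intro g t hg ht
  set d := fhat - T fhat with hd
  have hSd : S d = d := (sub_eq_zero.mp hopt).symm
  have hTd : T d = 0 := by rw [hd, map_sub, hT_idem, sub_self]
  have inner_fixed (u : H) (hu : T u = u) : ⟪d, u⟫ = 0 := by
    rw [← hu, ← hT_sa, hTd, inner_zero_left]
  have inner_consistent : ⟪d, g⟫ = ⟪d, fhat⟫ := by
    rw [← hSd, hS_sa, hS_sa, hg, hcons]
  have inner_eq : ⟪d, g - t⟫ = ‖d‖ * ‖d‖ := by
    have hsplit : fhat = d + T fhat := by rw [hd, sub_add_cancel]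
    rw [inner_sub_right, inner_fixed t ht, inner_consistent, hsplit, inner_add_right,
      inner_fixed _ (hT_idem fhat), real_inner_self_eq_norm_mul_norm]
    ring
  have hle : ‖d‖ * ‖d‖ ≤ ‖d‖ * ‖g - t‖ := inner_eq ▸ real_inner_le_norm d (g - t)
  rcases (norm_nonneg d).eq_or_lt with h | h
  · exact h ▸ norm_nonneg _
  · exact le_of_mul_le_mul_left hle h
end

section
/- Let H be a real Hilbert space, let S, T : H → H be orthogonal projections, and fix f ∈ H. Suppose f̂ ∈ H satisfies S f̂ = S f and (I − S)(I − T) f̂ = 0. Then T f̂ is a generalized reconstruction, i.e., T f̂ minimizes the distance to the sample-consistent plane among elements of the guiding subspace: ‖S(T f̂) − S f‖ = ‖f̂ − T f̂‖, and for every t ∈ H with T t = t, ‖S(T f̂) − S f‖ ≤ ‖S t − S f‖. -/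
open scoped RealInnerProductSpace

theorem stmt_8 {H : Type*} [NormedAddCommGroup H] [InnerProductSpace ℝ H] [CompleteSpace H]
    (S T : H →L[ℝ] H)
    (hS_idem : ∀ x, S (S x) = S x)
    (hS_sa : ∀ x y, ⟪S x, y⟫ = ⟪x, S y⟫)
    (hT_idem : ∀ x, T (T x) = T x)
    (hT_sa : ∀ x y, ⟪T x, y⟫ = ⟪x, T y⟫)
    (f fhat : H)
    (hcons : S fhat = S f)
    (hopt : (fhat - T fhat) - S (fhat - T fhat) = 0) :
    ‖S (T fhat) - S f‖ = ‖fhat - T fhat‖ ∧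
      ∀ t : H, T t = t → ‖S (T fhat) - S f‖ ≤ ‖S t - S f‖ := by
  have hSe : S (fhat - T fhat) = fhat - T fhat := (sub_eq_zero.mp hopt).symm
  have hnorm : ‖S (T fhat) - S f‖ = ‖fhat - T fhat‖ := by
    rw [← hcons, ← map_sub, ← neg_sub fhat, map_neg, hSe, norm_neg]
  refine ⟨hnorm, fun t ht => ?_⟩
  rw [hnorm]
  set e := fhat - T fhat with he
  have hTe : T e = 0 := by rw [he, map_sub, hT_idem, sub_self]
  have horth : ⟪S (t - T fhat), e⟫ = 0 := by
    have hT : T (t - T fhat) = t - T fhat := by rw [map_sub, ht, hT_idem]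
    rw [hS_sa, hSe, ← hT, hT_sa, hTe, inner_zero_right]
  have hdecomp : S t - S f = S (t - T fhat) - e := by
    rw [← hcons, ← hSe, he]
    simp only [map_sub]
    abel
  have hpyth := norm_sub_sq_real (S (t - T fhat)) e
  rw [horth] at hpyth
  rw [hdecomp]
  refine (abs_le_of_sq_le_sq' ?_ (norm_nonneg _)).2
  nlinarith [sq_nonneg ‖S (t - T fhat)‖]
end

section
/- Let H be a real Hilbert space, let S, T : H → H be orthogonal projections, and fix f ∈ H. Suppose f̂ ∈ H satisfies S f̂ = S f and (I − S)(I − T) f̂ = 0. Then ‖f − T f̂‖² = ‖f − f̂‖² + ‖f̂ − T f̂‖²; in particular, the reconstruction error of the consistent reconstruction never exceeds that of the generalized reconstruction: ‖f − f̂‖ ≤ ‖f − T f̂‖. -/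
open scoped RealInnerProductSpace

theorem stmt_10 {H : Type*} [NormedAddCommGroup H] [InnerProductSpace ℝ H] [CompleteSpace H]
    (S T : H →L[ℝ] H)
    (hS_idem : ∀ x, S (S x) = S x)
    (hS_sa : ∀ x y, ⟪S x, y⟫ = ⟪x, S y⟫)
    (hT_idem : ∀ x, T (T x) = T x)
    (hT_sa : ∀ x y, ⟪T x, y⟫ = ⟪x, T y⟫)
    (f fhat : H)
    (hcons : S fhat = S f)
    (hopt : (fhat - T fhat) - S (fhat - T fhat) = 0) :
    ‖f - T fhat‖ ^ 2 = ‖f - fhat‖ ^ 2 + ‖fhat - T fhat‖ ^ 2 ∧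
      ‖f - fhat‖ ≤ ‖f - T fhat‖ := by
  have orth : ⟪f - fhat, fhat - T fhat⟫ = 0 := by
    rw [sub_eq_zero.mp hopt, ← hS_sa, map_sub, hcons, sub_self, inner_zero_left]
  have pythagoras : ‖f - T fhat‖ ^ 2 = ‖f - fhat‖ ^ 2 + ‖fhat - T fhat‖ ^ 2 := by
    rw [← sub_add_sub_cancel f fhat (T fhat), norm_add_sq_real, orth]
    ring
  refine ⟨pythagoras, pow_le_pow_iff_left₀ (norm_nonneg _) (norm_nonneg _) two_ne_zero |>.mp ?_⟩
  rw [pythagoras]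
  exact le_add_of_nonneg_right (sq_nonneg _)
end

section
/- Let H be a real Hilbert space, let S, T : H → H be orthogonal projections with 𝒯 + 𝒮⊥ = H (every element of H is a sum of an element of range T and an element of ker S), and fix f ∈ H. If f̂ minimizes g ↦ ‖g − T g‖ over the sample-consistent plane {g ∈ H : S g = S f}, then f̂ lies in the guiding subspace, i.e., T f̂ = f̂; thus in this case the consistent reconstruction coincides with the oblique projection of f onto 𝒯 along 𝒮⊥. -/
open scoped RealInnerProductSpace

theorem stmt_13 {H : Type*} [NormedAddCommGroup H] [InnerProductSpace ℝ H] [CompleteSpace H]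
    (S T : H →L[ℝ] H)
    (hS_idem : ∀ x, S (S x) = S x)
    (hS_sa : ∀ x y, ⟪S x, y⟫ = ⟪x, S y⟫)
    (hT_idem : ∀ x, T (T x) = T x)
    (hT_sa : ∀ x y, ⟪T x, y⟫ = ⟪x, T y⟫)
    (hsum : ∀ x : H, ∃ t u : H, T t = t ∧ S u = 0 ∧ x = t + u)
    (f fhat : H)
    (hcons : S fhat = S f)
    (hmin : ∀ g : H, S g = S f → ‖fhat - T fhat‖ ≤ ‖g - T g‖) :
    T fhat = fhat := by
  obtain ⟨t, u, ht, hu, hf⟩ := hsum f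
  have h := hmin t (by rw [hf, map_add, hu, add_zero])
  rw [ht, sub_self, norm_zero, norm_le_zero_iff, sub_eq_zero] at h
  exact h.symm
end
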